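/- arXiv:1102.0728 — 3 statements merged into one kernel-verified Lean document; each statement's English description precedes it below -/
import Mathlib

section
/- Let B be a nonzero antisymmetric real 3×3 matrix, ρ = (½ ‖B‖_F²)^{1/2} > 0, and for (x,y) on the unit circle S¹ ⊂ ℝ² define the 3×3 matrix s(x,y) = ((1−x)/ρ²) B² + (y/ρ) B + I. Then s(p) s(q) = s(p·q) for all p, q ∈ S¹, where p·q denotes the group multiplication on S¹ given by complex multiplication: (x,y)·(x',y') = (xx'−yy', xy'+x'y). -/
/-- For a nonzero antisymmetric real `3 × 3` matrix `B` with
`ρ = (½ ‖B‖_F²)^{1/2}`, the map `s(x,y) = ((1-x)/ρ²) B² + (y/ρ) B + I`, defined for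
`(x,y)` on the unit circle, is multiplicative for the circle group structure
`(x,y)·(x',y') = (xx'-yy', xy'+x'y)`. -/
theorem sMap_mul
    (B : Matrix (Fin 3) (Fin 3) ℝ) (hB : B.transpose = -B) (hB0 : B ≠ 0)
    (ρ : ℝ) (hρ : ρ = Real.sqrt (2⁻¹ * ∑ i : Fin 3, ∑ j : Fin 3, B i j ^ 2))
    (s : ℝ → ℝ → Matrix (Fin 3) (Fin 3) ℝ)
    (hs : ∀ x y : ℝ, s x y = ((1 - x) / ρ ^ 2) • B ^ 2 + (y / ρ) • B + 1) :
    ∀ x y x' y' : ℝ, x ^ 2 + y ^ 2 = 1 → x' ^ 2 + y' ^ 2 = 1 →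
      s x y * s x' y' = s (x * x' - y * y') (x * y' + x' * y) := by
  have h := fun i j => congrFun (congrFun hB i) j
  simp only [Matrix.transpose_apply, Matrix.neg_apply] at h
  have h00 : B 0 0 = 0 := by linarith [h 0 0]
  have h11 : B 1 1 = 0 := by linarith [h 1 1]
  have h22 : B 2 2 = 0 := by linarith [h 2 2]
  have h10 := h 0 1
  have h20 := h 0 2
  have h21 := h 1 2
  have hsq : ρ ^ 2 = B 0 1 ^ 2 + B 0 2 ^ 2 + B 1 2 ^ 2 := by
    rw [hρ, Real.sq_sqrt (by positivity)]
    simp only [Fin.sum_univ_three, h00, h11, h22, h10, h20, h21]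
    ring
  have h3 : B ^ 3 = (-ρ ^ 2) • B := by
    rw [hsq]
    ext i j
    fin_cases i <;> fin_cases j <;>
      simp [pow_succ, Matrix.mul_apply, Fin.sum_univ_three, h00, h11, h22, h10, h20, h21] <;> ring
  have h4 : B ^ 4 = (-ρ ^ 2) • B ^ 2 := by
    rw [pow_succ, h3, smul_mul_assoc, ← sq]
  intro x y x' y' _ _
  by_cases h0 : ρ = 0
  · simp [hs, h0]
  have key : ∀ a b a' b' : ℝ, (a • B ^ 2 + b • B + 1) * (a' • B ^ 2 + b' • B + 1)
      = (a + a' + b * b' - a * a' * ρ ^ 2) • B ^ 2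
        + (b + b' - (a * b' + a' * b) * ρ ^ 2) • B + 1 := by
    intro a b a' b'
    have e1 : B ^ 2 * B ^ 2 = (-ρ ^ 2) • B ^ 2 := by rw [← pow_add, h4]
    have e2 : B ^ 2 * B = (-ρ ^ 2) • B := by rw [← pow_succ, h3]
    have e3 : B * B ^ 2 = (-ρ ^ 2) • B := by rw [← pow_succ', h3]
    have e4 : B * B = B ^ 2 := (sq B).symm
    simp only [add_mul, mul_add, smul_mul_assoc, mul_smul_comm, e1, e2, e3, e4, mul_one, one_mul]
    module
  rw [hs, hs, hs, key]
  congr 3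
  · field_simp
    ring
  · field_simp
    ring
end

section
/- Let B be a nonzero antisymmetric real 3×3 matrix, ρ = (½ ‖B‖_F²)^{1/2} > 0, and for (x,y) ∈ S¹ define s(x,y) = ((1−x)/ρ²) B² + (y/ρ) B + I. Then s(p) belongs to the special orthogonal group SO₃ for every p ∈ S¹: s(p)ᵀ s(p) = I and det s(p) = 1. -/
theorem aux_rot (a b c x y : ℝ) (h1 : a ^ 2 + b ^ 2 + c ^ 2 = 1) (h2 : x ^ 2 + y ^ 2 = 1)
    (N S : Matrix (Fin 3) (Fin 3) ℝ) (hN : N = !![0, a, b; -a, 0, c; -b, -c, 0])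
    (hS : S = (1 - x) • N ^ 2 + y • N + 1) : S.transpose * S = 1 ∧ S.det = 1 := by
  have hT : N.transpose = -N := by
    rw [hN]; ext i j; fin_cases i <;> fin_cases j <;> simp
  have h3 : N * N * N = -N := by
    rw [hN]; ext i j
    fin_cases i <;> fin_cases j <;> simp [Matrix.mul_apply, Fin.sum_univ_three]
    · ring
    · linear_combination (-a) * h1
    · linear_combination (-b) * h1
    · linear_combination a * h1
    · ring
    · linear_combination (-c) * h1
    · linear_combination b * h1
    · linear_combination c * h1
    · ring
  constructor
  · have hST : S.transpose = (1 - x) • N ^ 2 - y • N + 1 := by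
      rw [hS]
      simp [Matrix.transpose_add, Matrix.transpose_smul, Matrix.transpose_pow, hT, sub_eq_add_neg]
    have h4 : N * N * N * N = -(N * N) := by rw [h3]; simp
    have e : S.transpose * S = ((1 - x) ^ 2) • (N * N * N * N)
        + (2 * (1 - x) - y ^ 2) • (N * N) + 1 := by
      rw [hST, hS]
      simp only [pow_two N, add_mul, mul_add, sub_mul, mul_sub, smul_mul_assoc, mul_smul_comm,
        mul_one, one_mul, ← mul_assoc]
      module
    rw [e, h4]
    have : (1 - x) ^ 2 = 2 * (1 - x) - y ^ 2 := by linear_combination h2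
    rw [this]; simp
  · have hM : S = !![1 - (1 - x) * (a ^ 2 + b ^ 2), y * a - (1 - x) * (b * c),
          y * b + (1 - x) * (a * c);
        -(y * a) - (1 - x) * (b * c), 1 - (1 - x) * (a ^ 2 + c ^ 2), y * c - (1 - x) * (a * b);
        -(y * b) + (1 - x) * (a * c), -(y * c) - (1 - x) * (a * b),
          1 - (1 - x) * (b ^ 2 + c ^ 2)] := by
      rw [hS, hN]; ext i j
      fin_cases i <;> fin_cases j <;>
        simp [pow_two, Matrix.mul_apply, Fin.sum_univ_three] <;> ring
    have hd : S.det = (1 - (1 - x) * (a ^ 2 + b ^ 2 + c ^ 2)) ^ 2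
        + y ^ 2 * (a ^ 2 + b ^ 2 + c ^ 2) := by
      rw [hM, Matrix.det_fin_three]; simp; ring
    rw [hd, h1]; linear_combination h2

/-- For a nonzero antisymmetric real `3 × 3` matrix `B` with
`ρ = (½ ‖B‖_F²)^{1/2}`, the matrix `s(x,y) = ((1-x)/ρ²) B² + (y/ρ) B + I` belongs to `SO₃`
for every `(x,y)` on the unit circle: `s(x,y)ᵀ s(x,y) = I` and `det s(x,y) = 1`. -/
theorem sMap_mem_SO3
    (B : Matrix (Fin 3) (Fin 3) ℝ) (hB : B.transpose = -B) (hB0 : B ≠ 0)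
    (ρ : ℝ) (hρ : ρ = Real.sqrt (2⁻¹ * ∑ i : Fin 3, ∑ j : Fin 3, B i j ^ 2))
    (s : ℝ → ℝ → Matrix (Fin 3) (Fin 3) ℝ)
    (hs : ∀ x y : ℝ, s x y = ((1 - x) / ρ ^ 2) • B ^ 2 + (y / ρ) • B + 1) :
    ∀ x y : ℝ, x ^ 2 + y ^ 2 = 1 →
      (s x y).transpose * s x y = 1 ∧ (s x y).det = 1 := by
  intro x y hxy
  have hij : ∀ i j, B j i = -B i j := fun i j => by
    have := congrFun (congrFun hB i) j
    simpa using this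
  have d0 : B 0 0 = 0 := by linarith [hij 0 0]
  have d1 : B 1 1 = 0 := by linarith [hij 1 1]
  have d2 : B 2 2 = 0 := by linarith [hij 2 2]
  have hBe : B = !![0, B 0 1, B 0 2; -B 0 1, 0, B 1 2; -B 0 2, -B 1 2, 0] := by
    ext i j
    fin_cases i <;> fin_cases j <;> simp [d0, d1, d2, hij 0 1, hij 0 2, hij 1 2]
  have hq : 2⁻¹ * ∑ i : Fin 3, ∑ j : Fin 3, B i j ^ 2
      = B 0 1 ^ 2 + B 0 2 ^ 2 + B 1 2 ^ 2 := by
    simp only [Fin.sum_univ_three, d0, d1, d2, hij 0 1, hij 0 2, hij 1 2]; ring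
  have hρ2 : ρ ^ 2 = B 0 1 ^ 2 + B 0 2 ^ 2 + B 1 2 ^ 2 := by
    rw [hρ, hq, Real.sq_sqrt (by positivity)]
  have hρ0 : ρ ≠ 0 := by
    intro h
    rw [h] at hρ2
    have e1 : B 0 1 = 0 := by
      apply pow_eq_zero_iff (two_ne_zero) |>.1
      nlinarith [sq_nonneg (B 0 1), sq_nonneg (B 0 2), sq_nonneg (B 1 2)]
    have e2 : B 0 2 = 0 := by
      apply pow_eq_zero_iff (two_ne_zero) |>.1
      nlinarith [sq_nonneg (B 0 1), sq_nonneg (B 0 2), sq_nonneg (B 1 2)]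
    have e3 : B 1 2 = 0 := by
      apply pow_eq_zero_iff (two_ne_zero) |>.1
      nlinarith [sq_nonneg (B 0 1), sq_nonneg (B 0 2), sq_nonneg (B 1 2)]
    apply hB0
    rw [hBe, e1, e2, e3]
    ext i j
    fin_cases i <;> fin_cases j <;> simp
  refine aux_rot (ρ⁻¹ * B 0 1) (ρ⁻¹ * B 0 2) (ρ⁻¹ * B 1 2) x y ?_ hxy (ρ⁻¹ • B) _ ?_ ?_
  · field_simp
    linarith
  · conv_lhs => rw [hBe]
    ext i j
    fin_cases i <;> fin_cases j <;> simp
  · rw [hs, smul_pow, smul_smul, smul_smul, inv_pow, div_eq_mul_inv, div_eq_mul_inv]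
end

section
/- Let B be a nonzero antisymmetric real 3×3 matrix, ρ = (½ ‖B‖_F²)^{1/2}, and s : S¹ → M₃(ℝ), s(x,y) = ((1−x)/ρ²) B² + (y/ρ) B + I. Let a : S¹ × M₃(ℝ) → M₃(ℝ), a(p,Z) = s(p)·Z, let dx be the normalized Haar probability measure on S¹, and for a Borel probability measure ν on M₃(ℝ) define ν̄ as the pushforward of the product measure dx ⊗ ν under a. Then for every Borel probability measure μ on S¹, the pushforward of μ ⊗ ν̄ under a equals ν̄. -/
open MeasureTheory

instance : MeasurableSpace (Matrix (Fin 3) (Fin 3) ℝ) := MeasurableSpace.pi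

/-- The unit circle `S¹ = {(x,y) ∈ ℝ² : x² + y² = 1}`. -/
def UnitCircle : Type := {p : ℝ × ℝ // p.1 ^ 2 + p.2 ^ 2 = 1}

instance : MeasurableSpace UnitCircle := by unfold UnitCircle; infer_instance

/-- The parametrization `θ ↦ (cos θ, sin θ)` of the unit circle. -/
noncomputable def circleParam (θ : ℝ) : UnitCircle :=
  ⟨(Real.cos θ, Real.sin θ), by simp⟩

/-- The normalized Haar (uniform) probability measure on the unit circle, realized as the
pushforward of normalized Lebesgue measure on `[0, 2π)` under `θ ↦ (cos θ, sin θ)`. -/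
noncomputable def haarCircle : Measure UnitCircle :=
  Measure.map circleParam
    ((ENNReal.ofReal (2 * Real.pi))⁻¹ • volume.restrict (Set.Ico 0 (2 * Real.pi)))

theorem aux_surj (p : UnitCircle) : ∃ φ, p = circleParam φ := by
  obtain ⟨⟨x, y⟩, h⟩ := p
  simp only at h
  have hn : ‖(⟨x, y⟩ : ℂ)‖ = 1 := by
    rw [Complex.norm_def, Complex.normSq_mk, Real.sqrt_eq_one]; linarith
  have h0 : (⟨x, y⟩ : ℂ) ≠ 0 := by
    intro h; rw [h] at hn; simp at hn
  refine ⟨Complex.arg ⟨x, y⟩, Subtype.ext (Prod.ext ?_ ?_)⟩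
  · simp [circleParam, Complex.cos_arg h0, hn]
  · simp [circleParam, Complex.sin_arg, hn]

theorem aux_meas_coe : Measurable (fun p : UnitCircle => (p.1 : ℝ × ℝ)) :=
  measurable_subtype_coe

theorem aux_meas_param : Measurable circleParam := by
  refine Measurable.subtype_mk ?_
  exact Real.measurable_cos.prodMk Real.measurable_sin

theorem aux_haar (g : UnitCircle → ENNReal) (hg : Measurable g) (φ : ℝ) :
    ∫⁻ θ in Set.Ico 0 (2 * Real.pi), g (circleParam (φ + θ)) =
      ∫⁻ θ in Set.Ico 0 (2 * Real.pi), g (circleParam θ) := by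
  have hm : Measurable fun θ => g (circleParam θ) := hg.comp aux_meas_param
  have hper : Function.Periodic (fun θ => g (circleParam θ)) (2 * Real.pi) := by
    intro θ; simp [circleParam]
  have hT : 0 < 2 * Real.pi := by positivity
  have : VAddInvariantMeasure (AddSubgroup.zmultiples (2 * Real.pi)) ℝ volume :=
    ⟨fun c s _ => measure_preimage_add _ _ _⟩
  have key := (isAddFundamentalDomain_Ioc hT φ).setLIntegral_eq (isAddFundamentalDomain_Ioc hT 0)
    (fun θ => g (circleParam θ)) hper.map_vadd_zmultiples
  rw [zero_add] at key
  rw [restrict_Ico_eq_restrict_Ioc, ← key]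
  have mp : MeasurePreserving (fun θ : ℝ => φ + θ) volume volume :=
    measurePreserving_add_left volume φ
  have h2 := (mp.restrict_preimage (s := Set.Ioc φ (φ + 2 * Real.pi)) measurableSet_Ioc).lintegral_comp hm
  rw [← h2]
  congr 2
  simp

theorem aux_cube (B : Matrix (Fin 3) (Fin 3) ℝ) (hB : B.transpose = -B)
    (ρ : ℝ) (hρ : ρ = Real.sqrt (2⁻¹ * ∑ i : Fin 3, ∑ j : Fin 3, B i j ^ 2)) :
    B ^ 3 = -(ρ ^ 2) • B := by
  have h2 : ρ ^ 2 = 2⁻¹ * ∑ i : Fin 3, ∑ j : Fin 3, B i j ^ 2 := by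
    rw [hρ, Real.sq_sqrt (by positivity)]
  have e : ∀ i j, B j i = - B i j := fun i j => congrFun (congrFun hB i) j
  have d0 : B 0 0 = 0 := by linarith [e 0 0]
  have d1 : B 1 1 = 0 := by linarith [e 1 1]
  have d2 : B 2 2 = 0 := by linarith [e 2 2]
  have e1 := e 0 1
  have e2 := e 0 2
  have e3 := e 1 2
  ext i j
  rw [h2]
  fin_cases i <;> fin_cases j <;>
    simp [pow_succ, Matrix.mul_apply, Fin.sum_univ_three, d0, d1, d2, e1, e2, e3] <;> ring

theorem aux_rho (B : Matrix (Fin 3) (Fin 3) ℝ) (hB0 : B ≠ 0)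
    (ρ : ℝ) (hρ : ρ = Real.sqrt (2⁻¹ * ∑ i : Fin 3, ∑ j : Fin 3, B i j ^ 2)) :
    ρ ≠ 0 := by
  intro h
  rw [h] at hρ
  have h1 := (Real.sqrt_eq_zero (by positivity)).1 hρ.symm
  have h2 : ∑ i : Fin 3, ∑ j : Fin 3, B i j ^ 2 = 0 := by linarith
  apply hB0
  ext i j
  rw [Finset.sum_eq_zero_iff_of_nonneg (fun i _ => by positivity)] at h2
  have h3 := h2 i (Finset.mem_univ _)
  rw [Finset.sum_eq_zero_iff_of_nonneg (fun i _ => by positivity)] at h3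
  simpa using h3 j (Finset.mem_univ _)

theorem aux_mul (B : Matrix (Fin 3) (Fin 3) ℝ) (ρ : ℝ) (h0 : ρ ≠ 0)
    (h3 : B ^ 3 = -(ρ ^ 2) • B) (x y x' y' : ℝ) :
    (((1 - x) / ρ ^ 2) • B ^ 2 + (y / ρ) • B + 1) *
      (((1 - x') / ρ ^ 2) • B ^ 2 + (y' / ρ) • B + 1) =
    ((1 - (x * x' - y * y')) / ρ ^ 2) • B ^ 2 + ((y * x' + x * y') / ρ) • B + 1 := by
  have h4 : B ^ 2 * B ^ 2 = -(ρ ^ 2) • B ^ 2 := by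
    rw [← pow_add, show 2 + 2 = 3 + 1 from rfl, pow_succ, h3, smul_mul_assoc, ← sq B]
  have h21 : B ^ 2 * B = -(ρ ^ 2) • B := by rw [← pow_succ, h3]
  have h12 : B * B ^ 2 = -(ρ ^ 2) • B := by rw [← pow_succ', h3]
  have h11 : B * B = B ^ 2 := (sq B).symm
  simp only [add_mul, mul_add, smul_mul_smul_comm, h4, h21, h12, h11, mul_one, one_mul, smul_smul]
  match_scalars <;> field_simp <;> ring

/-- Let `B` be a nonzero antisymmetric real `3 × 3` matrix,
`ρ = (½‖B‖_F²)^{1/2}`, `s(x,y) = ((1-x)/ρ²)B² + (y/ρ)B + I` and `a(p,Z) = s(p)·Z`.  If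
`ν̄ = a_*(dx ⊗ ν)` with `dx` the normalized Haar measure on `S¹` and `ν` a Borel probability
measure on `M₃(ℝ)`, then `a_*(μ ⊗ ν̄) = ν̄` for every Borel probability measure `μ` on `S¹`. -/
theorem pushforward_prod_bar_eq_bar
    (B : Matrix (Fin 3) (Fin 3) ℝ) (hB : B.transpose = -B) (hB0 : B ≠ 0)
    (ρ : ℝ) (hρ : ρ = Real.sqrt (2⁻¹ * ∑ i : Fin 3, ∑ j : Fin 3, B i j ^ 2))
    (s : UnitCircle → Matrix (Fin 3) (Fin 3) ℝ)
    (hs : ∀ p : UnitCircle,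
      s p = ((1 - p.1.1) / ρ ^ 2) • B ^ 2 + (p.1.2 / ρ) • B + 1)
    (a : UnitCircle × Matrix (Fin 3) (Fin 3) ℝ → Matrix (Fin 3) (Fin 3) ℝ)
    (ha : ∀ q : UnitCircle × Matrix (Fin 3) (Fin 3) ℝ, a q = s q.1 * q.2)
    (ν : Measure (Matrix (Fin 3) (Fin 3) ℝ)) [IsProbabilityMeasure ν]
    (νbar : Measure (Matrix (Fin 3) (Fin 3) ℝ))
    (hνbar : νbar = Measure.map a (haarCircle.prod ν))
    (μ : Measure UnitCircle) [IsProbabilityMeasure μ] :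
    Measure.map a (μ.prod νbar) = νbar := by
  have hρ0 := aux_rho B hB0 ρ hρ
  have h3 := aux_cube B hB ρ hρ
  have hsm : ∀ φ θ, s (circleParam (φ + θ)) = s (circleParam φ) * s (circleParam θ) := by
    intro φ θ
    rw [hs, hs, hs, aux_mul B ρ hρ0 h3]
    simp [circleParam, Real.cos_add, Real.sin_add]
  have hsmeas : ∀ i j, Measurable fun p => s p i j := by
    intro i j
    have h1 : Measurable fun p : UnitCircle => p.1.1 := measurable_fst.comp aux_meas_coe
    have h2 : Measurable fun p : UnitCircle => p.1.2 := measurable_snd.comp aux_meas_coe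
    simp only [hs, Matrix.add_apply, Matrix.smul_apply, smul_eq_mul]
    fun_prop
  have hmeas_entry : ∀ i j, Measurable fun Z : Matrix (Fin 3) (Fin 3) ℝ => Z i j := fun i j =>
    (measurable_pi_apply j).comp (measurable_pi_apply i)
  have hameas : Measurable a := by
    refine measurable_pi_iff.2 fun i => measurable_pi_iff.2 fun j => ?_
    simp only [ha, Matrix.mul_apply]
    exact Finset.measurable_sum _ fun k _ =>
      ((hsmeas i k).comp measurable_fst).mul ((hmeas_entry k j).comp measurable_snd)
  have hfin : IsFiniteMeasure haarCircle := by
    unfold haarCircle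
    have : IsFiniteMeasure ((ENNReal.ofReal (2 * Real.pi))⁻¹ •
        (volume : Measure ℝ).restrict (Set.Ico 0 (2 * Real.pi))) :=
      Measure.smul_finite _ (by simp [Real.pi_pos])
    infer_instance
  have hfin2 : IsFiniteMeasure νbar := by rw [hνbar]; infer_instance
  -- invariance of `νbar` under one rotation
  have hinv : ∀ (p : UnitCircle) (f : Matrix (Fin 3) (Fin 3) ℝ → ENNReal), Measurable f →
      ∫⁻ Z, f (a (p, Z)) ∂νbar = ∫⁻ Z, f Z ∂νbar := by
    intro p f hf
    have hap : Measurable fun Z => a (p, Z) := hameas.comp measurable_prodMk_left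
    have m1 : Measurable fun Z => f (a (p, Z)) := hf.comp hap
    have m2 : Measurable fun q => f (a (p, a q)) := m1.comp hameas
    have m3 : Measurable fun q => f (a q) := hf.comp hameas
    rw [hνbar, lintegral_map m1 hameas, lintegral_map hf hameas,
      lintegral_prod_symm _ m2.aemeasurable,
      lintegral_prod_symm _ m3.aemeasurable]
    refine lintegral_congr fun Z => ?_
    have haZ : Measurable fun q => a (q, Z) := hameas.comp measurable_prodMk_right
    obtain ⟨φ, rfl⟩ := aux_surj p
    have hL : Measurable fun q => f (a (circleParam φ, a (q, Z))) := hf.comp (hap.comp haZ)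
    have hR : Measurable fun q => f (a (q, Z)) := hf.comp haZ
    unfold haarCircle
    rw [lintegral_map hL aux_meas_param, lintegral_map hR aux_meas_param,
      lintegral_smul_measure, lintegral_smul_measure, ← aux_haar _ hR φ]
    simp only [ha, hsm, Matrix.mul_assoc]
  refine Measure.ext_of_lintegral _ fun f hf => ?_
  have m3 : Measurable fun q => f (a q) := hf.comp hameas
  rw [lintegral_map hf hameas, lintegral_prod _ m3.aemeasurable]
  simp [hinv _ f hf]
end
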